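/- Let M be a crossing-free matching of P and let p ∈ P be isolated in M. If the left bifurcation point of p exists and is isolated in M, then Σ_{i=0}^{4} (4−i)·l_i(p,M) ≤ 10. -/

import Mathlib

open scoped Classical

noncomputable section

/-- A point of the plane. -/
abbrev Pt : Type := ℝ × ℝ

/-- The closed straight-line segment with endpoints `a` and `b`. -/
def Seg (a b : Pt) : Set Pt := segment ℝ a b

/-- `P` is in general position: no three points of `P` are collinear and
no two points of `P` have the same `x`-coordinate. -/
def GenPos (P : Finset Pt) : Prop :=
  (∀ p ∈ P, ∀ q ∈ P, ∀ r ∈ P, p ≠ q → q ≠ r → p ≠ r →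
      ¬ Collinear ℝ ({p, q, r} : Set Pt)) ∧
  ∀ p ∈ P, ∀ q ∈ P, p ≠ q → p.1 ≠ q.1

/-- `M` is a crossing-free matching of `P`.  Each edge is recorded as an ordered
pair `(left endpoint, right endpoint)`, the left endpoint being the one of
smaller `x`-coordinate.  No point is an endpoint of more than one edge and no
two distinct edges intersect. -/
structure IsMatching (P : Finset Pt) (M : Finset (Pt × Pt)) : Prop where
  left_mem : ∀ e ∈ M, e.1 ∈ P
  right_mem : ∀ e ∈ M, e.2 ∈ P
  x_lt : ∀ e ∈ M, e.1.1 < e.2.1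
  no_shared : ∀ e ∈ M, ∀ f ∈ M, e ≠ f →
      e.1 ≠ f.1 ∧ e.1 ≠ f.2 ∧ e.2 ≠ f.1 ∧ e.2 ≠ f.2
  no_cross : ∀ e ∈ M, ∀ f ∈ M, e ≠ f → Seg e.1 e.2 ∩ Seg f.1 f.2 = ∅

/-- `p` is isolated in `M`: it is an endpoint of no edge of `M`. -/
def Isolated (M : Finset (Pt × Pt)) (p : Pt) : Prop :=
  ∀ e ∈ M, e.1 ≠ p ∧ e.2 ≠ p

/-- The `y`-coordinate of the point of the line through the endpoints of `e`
having abscissa `x`. -/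
def yOn (e : Pt × Pt) (x : ℝ) : ℝ :=
  e.1.2 + (x - e.1.1) * (e.2.2 - e.1.2) / (e.2.1 - e.1.1)

/-- The point of (the line supporting) the edge `e` with the same
`x`-coordinate as `q`. -/
def vproj (e : Pt × Pt) (q : Pt) : Pt := (q.1, yOn e q.1)

/-- `q` is vertically visible from the interior of the edge `e` of `M`:
its `x`-coordinate lies strictly between the `x`-coordinates of the endpoints
of `e`, and the open vertical segment joining `q` to the point of `e` with the
same `x`-coordinate meets no edge of `M` and contains no point of `P`. -/
def VertVisible (P : Finset Pt) (M : Finset (Pt × Pt)) (q : Pt) (e : Pt × Pt) : Prop :=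
  e.1.1 < q.1 ∧ q.1 < e.2.1 ∧
  (∀ f ∈ M, openSegment ℝ q (vproj e q) ∩ Seg f.1 f.2 = ∅) ∧
  ∀ r ∈ P, r ∉ openSegment ℝ q (vproj e q)

/-- `p` is the left endpoint of some edge of `M`. -/
def IsLeftEndpoint (M : Finset (Pt × Pt)) (p : Pt) : Prop := ∃ e ∈ M, e.1 = p

/-- `p` is the right endpoint of some edge of `M`. -/
def IsRightEndpoint (M : Finset (Pt × Pt)) (p : Pt) : Prop := ∃ e ∈ M, e.2 = p

/-- The rank `d_M(p)` of `p` in `M`. -/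
def rank (P : Finset Pt) (M : Finset (Pt × Pt)) (p : Pt) : ℕ :=
  if h : ∃ e ∈ M, e.1 = p then
    (P.filter fun q =>
      (Isolated M q ∨ IsLeftEndpoint M q) ∧ VertVisible P M q h.choose).card
  else if h' : ∃ e ∈ M, e.2 = p then
    (P.filter fun q =>
      (Isolated M q ∨ IsRightEndpoint M q) ∧ VertVisible P M q h'.choose).card
  else 0

/-- The result of inserting the edge `qp` into `M` (oriented left-to-right). -/
def addEdge (M : Finset (Pt × Pt)) (q p : Pt) : Finset (Pt × Pt) :=
  if q.1 < p.1 then insert (q, p) M else insert (p, q) M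

/-- `h_i(p,M)`: the number of points `q ∈ P` such that `M ∪ {qp}` is a
crossing-free matching of `P` in which `p` has rank `i`. -/
def hcount (P : Finset Pt) (M : Finset (Pt × Pt)) (p : Pt) (i : ℕ) : ℕ :=
  (P.filter fun q =>
    IsMatching P (addEdge M q p) ∧ rank P (addEdge M q p) p = i).card

/-- `l_i(p,M)`: the number of points `q ∈ P` to the left of `p` such that
`M ∪ {qp}` is a crossing-free matching of `P` in which `p` has rank `i`. -/
def lcount (P : Finset Pt) (M : Finset (Pt × Pt)) (p : Pt) (i : ℕ) : ℕ :=
  (P.filter fun q => q.1 < p.1 ∧ IsMatching P (insert (q, p) M) ∧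
    rank P (insert (q, p) M) p = i).card

/-- `v_i(M)`: the number of points of `P` of rank `i` in `M`. -/
def vcount (P : Finset Pt) (M : Finset (Pt × Pt)) (i : ℕ) : ℕ :=
  (P.filter fun p => rank P M p = i).card

/-- The (finite) collection of crossing-free matchings of `P` with `m` edges. -/
def Matchings (P : Finset Pt) (m : ℕ) : Finset (Finset (Pt × Pt)) :=
  (P ×ˢ P).powerset.filter fun M => IsMatching P M ∧ M.card = m

/-- `Ma_m(P)`: the number of crossing-free matchings of `P` with `m` edges. -/
def Ma (P : Finset Pt) (m : ℕ) : ℕ := (Matchings P m).card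

/-- `S_k(m)`: the sum of `Σ_{i=0}^{k} (k-i) h_i(p,M')` over all pairs `(p, M')`
with `M'` a crossing-free matching of `P` with `m-1` edges and `p ∈ P`
isolated in `M'`. -/
def Ssum (P : Finset Pt) (k m : ℕ) : ℕ :=
  ∑ M ∈ Matchings P (m - 1), ∑ p ∈ P.filter (fun p => Isolated M p),
    ∑ i ∈ Finset.range (k + 1), (k - i) * hcount P M p i

/-- The union of the edges of `M`, as a subset of the plane. -/
def edgesSet (M : Finset (Pt × Pt)) : Set Pt := ⋃ e ∈ M, Seg e.1 e.2

/-- The vertical wall of `r`: the maximal open vertical segment through `r`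
meeting no edge of `M` except possibly at `r` itself. -/
def Wall (M : Finset (Pt × Pt)) (r : Pt) : Set Pt :=
  {x : Pt | x.1 = r.1 ∧
    ∀ z : Pt, z.1 = r.1 → z.2 ∈ Set.uIcc x.2 r.2 → z ≠ r → z ∉ edgesSet M}

/-- The complement of the union of all edges of `M` and all vertical walls of
points of `P`; its connected components are the cells of the vertical
decomposition. -/
def FreeRegion (P : Finset Pt) (M : Finset (Pt × Pt)) : Set Pt :=
  (edgesSet M ∪ ⋃ r ∈ P, Wall M r)ᶜ

/-- `T` is a cell of the vertical decomposition of `M`. -/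
def IsCell (P : Finset Pt) (M : Finset (Pt × Pt)) (T : Set Pt) : Prop :=
  ∃ x ∈ FreeRegion P M, T = connectedComponentIn (FreeRegion P M) x

/-- `T` is the cell containing the points `(x(p) - ε, y(p))` for all
sufficiently small `ε > 0`. -/
def IsLeftCellOf (P : Finset Pt) (M : Finset (Pt × Pt)) (p : Pt) (T : Set Pt) : Prop :=
  IsCell P M T ∧ ∃ ε₀ > (0 : ℝ), ∀ ε : ℝ, 0 < ε → ε < ε₀ →
    ((p.1 - ε, p.2) : Pt) ∈ T

/-- `T` is the cell containing the points `(x(p) + ε, y(p))` for all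
sufficiently small `ε > 0`. -/
def IsRightCellOf (P : Finset Pt) (M : Finset (Pt × Pt)) (p : Pt) (T : Set Pt) : Prop :=
  IsCell P M T ∧ ∃ ε₀ > (0 : ℝ), ∀ ε : ℝ, 0 < ε → ε < ε₀ →
    ((p.1 + ε, p.2) : Pt) ∈ T

/-- `q` is the left bifurcation point of `p`: part of the boundary of the cell
to the left of `p` lies on the vertical wall of `q`, and `x(q)` is the infimum
of the abscissas of points of that cell. -/
def IsLeftBifPoint (P : Finset Pt) (M : Finset (Pt × Pt)) (p q : Pt) : Prop :=
  q ∈ P ∧ ∃ T, IsLeftCellOf P M p T ∧ (frontier T ∩ Wall M q).Nonempty ∧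
    IsGLB {x : ℝ | ∃ y : ℝ, ((x, y) : Pt) ∈ T} q.1

/-- `q` is the right bifurcation point of `p`. -/
def IsRightBifPoint (P : Finset Pt) (M : Finset (Pt × Pt)) (p q : Pt) : Prop :=
  q ∈ P ∧ ∃ T, IsRightCellOf P M p T ∧ (frontier T ∩ Wall M q).Nonempty ∧
    IsLUB {x : ℝ | ∃ y : ℝ, ((x, y) : Pt) ∈ T} q.1

/-- The edge `e` of `M` is vertically visible below `p`. -/
def EdgeVisBelow (P : Finset Pt) (M : Finset (Pt × Pt)) (e : Pt × Pt) (p : Pt) : Prop :=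
  e.1.1 < p.1 ∧ p.1 < e.2.1 ∧ yOn e p.1 < p.2 ∧
  (∀ f ∈ M, openSegment ℝ p (vproj e p) ∩ Seg f.1 f.2 = ∅) ∧
  ∀ r ∈ P, r ∉ openSegment ℝ p (vproj e p)

/-- The edge `e` of `M` is vertically visible above `p`. -/
def EdgeVisAbove (P : Finset Pt) (M : Finset (Pt × Pt)) (e : Pt × Pt) (p : Pt) : Prop :=
  e.1.1 < p.1 ∧ p.1 < e.2.1 ∧ p.2 < yOn e p.1 ∧
  (∀ f ∈ M, openSegment ℝ p (vproj e p) ∩ Seg f.1 f.2 = ∅) ∧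
  ∀ r ∈ P, r ∉ openSegment ℝ p (vproj e p)

end


theorem yOn_left (e : Pt × Pt) : yOn e e.1.1 = e.1.2 := by simp [yOn]

theorem yOn_right (e : Pt × Pt) (h : e.1.1 < e.2.1) : yOn e e.2.1 = e.2.2 := by
  have : e.2.1 - e.1.1 ≠ 0 := by linarith
  simp [yOn]; field_simp; ring

theorem yOn_cont (e : Pt × Pt) : Continuous (yOn e) := by
  unfold yOn; fun_prop

theorem mem_Seg_iff (e : Pt × Pt) (h : e.1.1 < e.2.1) (z : Pt) :
    z ∈ Seg e.1 e.2 ↔ e.1.1 ≤ z.1 ∧ z.1 ≤ e.2.1 ∧ z.2 = yOn e z.1 := by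
  obtain ⟨⟨a, b⟩, ⟨c, d⟩⟩ := e
  obtain ⟨x, y⟩ := z
  have hne : c - a ≠ 0 := by simp at h; linarith
  have hpos : 0 < c - a := by simp at h; linarith
  simp only [Seg, segment, yOn, Set.mem_ofPred_eq, Prod.smul_mk, Prod.mk_add_mk, Prod.mk.injEq,
    smul_eq_mul]
  constructor
  · rintro ⟨s, t, hs, ht, hst, h1, h2⟩
    have hs' : s = 1 - t := by linarith
    subst hs'
    subst h1 h2
    refine ⟨by nlinarith, by nlinarith, ?_⟩
    field_simp; ring
  · rintro ⟨h1, h2, h3⟩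
    refine ⟨(c - x) / (c - a), (x - a) / (c - a), by apply div_nonneg <;> linarith,
      by apply div_nonneg <;> linarith, by field_simp; ring, by field_simp; ring, ?_⟩
    rw [h3]; field_simp; ring

theorem mem_openSeg (w : Pt) (y : ℝ) (hy : w.2 ≠ y) (z : Pt)
    (hz : z ∈ openSegment ℝ w ((w.1, y) : Pt)) :
    z.1 = w.1 ∧ (w.2 - z.2) * (y - z.2) < 0 := by
  obtain ⟨s, t, hs, ht, hst, rfl⟩ := hz
  have hs' : s = 1 - t := by linarith
  subst hs'
  constructor
  · simp; ring
  · simp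
    have : 0 < (w.2 - y)^2 := by have := sub_ne_zero.2 hy; positivity
    have h2 := mul_pos (mul_pos hs ht) this
    nlinarith

/-- Candidate left partner. -/
def Cand (P : Finset Pt) (M : Finset (Pt × Pt)) (p c : Pt) : Prop :=
  c.1 < p.1 ∧ IsMatching P (insert (c, p) M)

section
variable {P : Finset Pt} {M : Finset (Pt × Pt)} {p : Pt}

theorem Cand.mem {c : Pt} (h : Cand P M p c) : c ∈ P :=
  h.2.left_mem (c, p) (Finset.mem_insert_self _ _)

theorem Cand.ne (hiso : Isolated M p) {c : Pt} {f : Pt × Pt} (hf : f ∈ M) : f ≠ (c, p) := by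
  rintro rfl; exact (hiso _ hf).2 rfl

theorem Cand.iso (hiso : Isolated M p) {c : Pt} (h : Cand P M p c) : Isolated M c := by
  intro f hf
  have := h.2.no_shared f (Finset.mem_insert_of_mem hf) (c, p) (Finset.mem_insert_self _ _)
    (Cand.ne hiso hf)
  exact ⟨this.1, this.2.2.1⟩

theorem Cand.yne (hM : IsMatching P M) (hiso : Isolated M p) {c : Pt} (h : Cand P M p c)
    {f : Pt × Pt} (hf : f ∈ M) {x : ℝ} (h1 : f.1.1 ≤ x) (h2 : x ≤ f.2.1)
    (h3 : c.1 ≤ x) (h4 : x ≤ p.1) : yOn f x ≠ yOn (c, p) x := by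
  intro he
  have := h.2.no_cross f (Finset.mem_insert_of_mem hf) (c, p) (Finset.mem_insert_self _ _)
    (Cand.ne hiso hf)
  have hx : ((x, yOn f x) : Pt) ∈ Seg f.1 f.2 ∩ Seg (c, p).1 (c, p).2 := by
    constructor
    · rw [mem_Seg_iff _ (hM.x_lt f hf)]; exact ⟨h1, h2, rfl⟩
    · rw [mem_Seg_iff _ h.1]; exact ⟨h3, h4, he⟩
  rw [this] at hx; exact hx

theorem Cand.lt_iff (hM : IsMatching P M) (hiso : Isolated M p) {c : Pt} (h : Cand P M p c)
    {f : Pt × Pt} (hf : f ∈ M) {x x' : ℝ} (h1 : f.1.1 ≤ x) (h4 : c.1 ≤ x) (hxx : x ≤ x')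
    (h2 : x' ≤ f.2.1) (h3 : x' ≤ p.1) :
    (yOn f x < yOn (c, p) x ↔ yOn f x' < yOn (c, p) x') := by
  have key : ∀ t ∈ Set.Icc x x', yOn f t - yOn (c, p) t ≠ 0 := fun t ht =>
    sub_ne_zero.2 (h.yne hM hiso hf (by linarith [ht.1]) (by linarith [ht.2])
      (by linarith [ht.1]) (by linarith [ht.2]))
  have hc : ContinuousOn (fun t => yOn f t - yOn (c, p) t) (Set.Icc x x') :=
    ((yOn_cont f).sub (yOn_cont _)).continuousOn
  constructor
  · intro hl
    by_contra hn
    obtain ⟨t, ht, h0⟩ := intermediate_value_Icc hxx hc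
      (show (0 : ℝ) ∈ Set.Icc _ _ from ⟨by simp; linarith, by simp; linarith⟩)
    exact key t ht h0
  · intro hl
    by_contra hn
    obtain ⟨t, ht, h0⟩ := intermediate_value_Icc' hxx hc
      (show (0 : ℝ) ∈ Set.Icc _ _ from ⟨by simp; linarith, by simp; linarith⟩)
    exact key t ht h0

theorem right_end (hM : IsMatching P M) (hiso : Isolated M p) {a b : Pt} (ha : Cand P M p a)
    (hb : Cand P M p b) {f : Pt × Pt} (hf : f ∈ M) {x : ℝ} (hax : a.1 ≤ x) (hbx : b.1 ≤ x)
    (hxp : x < p.1) (h1 : f.1.1 ≤ x) (h2 : x ≤ f.2.1)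
    (hfa : yOn f x < yOn (a, p) x) (hfb : yOn (b, p) x < yOn f x) :
    f.2.1 < p.1 ∧ yOn (b, p) f.2.1 < f.2.2 ∧ f.2.2 < yOn (a, p) f.2.1 := by
  by_cases hc : f.2.1 < p.1
  · have A := (ha.lt_iff hM hiso hf h1 hax h2 le_rfl hc.le).1 hfa
    have B := mt (hb.lt_iff hM hiso hf h1 hbx h2 le_rfl hc.le).2 hfb.not_gt
    have C := hb.yne hM hiso hf (h1.trans h2) le_rfl (hbx.trans h2) hc.le
    rw [yOn_right f (hM.x_lt f hf)] at A B C
    exact ⟨hc, lt_of_le_of_ne (not_lt.1 B) C.symm, A⟩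
  · push Not at hc
    have A := (ha.lt_iff hM hiso hf h1 hax hxp.le hc le_rfl).1 hfa
    have B := mt (hb.lt_iff hM hiso hf h1 hbx hxp.le hc le_rfl).2 hfb.not_gt
    have e1 := yOn_right (a, p) ha.1
    have e2 := yOn_right (b, p) hb.1
    simp only at e1 e2
    rw [e1] at A; rw [e2] at B; exact absurd A B

theorem Cand.gp (hP : GenPos P) (hp : p ∈ P) {c w : Pt} (h : Cand P M p c) (hw : w ∈ P)
    (h1 : c.1 < w.1) (h2 : w.1 < p.1) : w.2 ≠ yOn (c, p) w.1 := by
  intro he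
  refine hP.1 c h.mem w hw p hp (fun h => by simp [h] at h1) (fun h => by simp [h] at h2)
    (fun h' => by have := h.1; simp [h'] at this) ?_
  have : w ∈ Seg (c, p).1 (c, p).2 := (mem_Seg_iff _ h.1 _).2 ⟨h1.le, h2.le, he⟩
  exact (mem_segment_iff_wbtw.1 this).collinear

theorem vis_of (hP : GenPos P) (hM : IsMatching P M) (hp : p ∈ P)
    {c w : Pt} (h : Cand P M p c) (hw : w ∈ P) (h1 : c.1 < w.1) (h2 : w.1 < p.1)
    (hb : ∀ f ∈ M, f.1.1 ≤ w.1 → w.1 ≤ f.2.1 →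
      ¬ (w.2 - yOn f w.1) * (yOn (c, p) w.1 - yOn f w.1) < 0) :
    VertVisible P (insert (c, p) M) w (c, p) := by
  have hne := h.gp hP hp hw h1 h2
  refine ⟨h1, h2, ?_, ?_⟩
  · intro f hf
    rw [Set.eq_empty_iff_forall_notMem]
    rintro z ⟨hz, hzf⟩
    obtain ⟨e, hz⟩ := mem_openSeg w _ hne z hz
    rw [Finset.mem_insert] at hf
    rcases hf with rfl | hf
    · rw [mem_Seg_iff _ h.1, e] at hzf
      rw [hzf.2.2] at hz; simp at hz
    · rw [mem_Seg_iff _ (hM.x_lt f hf), e] at hzf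
      rw [hzf.2.2] at hz
      exact hb f hf hzf.1 hzf.2.1 hz
  · intro r hr hz
    obtain ⟨e, hz⟩ := mem_openSeg w _ hne r hz
    have : r = w := by by_contra hrw; exact hP.2 r hr w hw hrw e
    subst this; simp at hz

/-- The counted points. -/
noncomputable def VV (P : Finset Pt) (M : Finset (Pt × Pt)) (p c : Pt) : Finset Pt :=
  P.filter fun q => (Isolated (insert (c, p) M) q ∨ IsRightEndpoint (insert (c, p) M) q) ∧
    VertVisible P (insert (c, p) M) q (c, p)

theorem rank_eq (hiso : Isolated M p) {c : Pt} (h : Cand P M p c) :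
    rank P (insert (c, p) M) p = (VV P M p c).card := by
  have h1 : ¬ ∃ e ∈ insert (c, p) M, e.1 = p := by
    rintro ⟨e, he, h'⟩
    rw [Finset.mem_insert] at he
    rcases he with rfl | he
    · have := h.1; simp at h'; simp [h'] at this
    · exact (hiso e he).1 h'
  have h2 : ∃ e ∈ insert (c, p) M, e.2 = p := ⟨(c, p), Finset.mem_insert_self _ _, rfl⟩
  have h3 : h2.choose = (c, p) := by
    obtain ⟨a, b⟩ := h2.choose_spec
    rw [Finset.mem_insert] at a
    rcases a with a | a
    · exact a
    · exact absurd b (hiso _ a).2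
  rw [rank, dif_neg h1, dif_pos h2, h3, VV]

theorem mem_VV {c w : Pt} (hw : w ∈ P)
    (hk : Isolated M w ∨ ∃ f ∈ M, f.2 = w)
    (hv : VertVisible P (insert (c, p) M) w (c, p)) : w ∈ VV P M p c := by
  refine Finset.mem_filter.2 ⟨hw, ?_, hv⟩
  rcases hk with hk | ⟨f, hf, h⟩
  · left
    intro e he
    rw [Finset.mem_insert] at he
    rcases he with rfl | he
    · have h1 := hv.1; have h2 := hv.2.1
      constructor
      · rintro rfl; simp at h1
      · rintro rfl; simp at h2
    · exact hk e he
  · right; exact ⟨f, Finset.mem_insert_of_mem hf, h⟩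

/-- The bound. -/
def ff : ℕ → ℕ
  | 0 => 12 | 1 => 6 | 2 => 3 | 3 => 1 | _ => 0

theorem ff1 (n : ℕ) : (4 - n) + ff (n + 1) ≤ ff n := by
  rcases n with _ | _ | _ | _ | _ | n <;> simp [ff]

theorem ff2 (n : ℕ) : ff (n + 1) + ff (n + 1) ≤ ff n := by
  rcases n with _ | _ | _ | _ | _ | n <;> simp [ff]

theorem main_ind (hP : GenPos P) (hM : IsMatching P M) (hp : p ∈ P) (hiso : Isolated M p)
    (n : ℕ) : ∀ S D : Finset Pt, S.card ≤ n → (∀ a ∈ S, Cand P M p a) →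
    (∀ a ∈ S, D ⊆ VV P M p a) →
    (∀ d ∈ D, Isolated M d ∨ ∀ a ∈ S, ∀ b ∈ S,
      (yOn (a, p) d.1 < d.2 ↔ yOn (b, p) d.1 < d.2)) →
    ∑ a ∈ S, (4 - (VV P M p a).card) ≤ ff D.card := by
  induction n with
  | zero =>
    intro S D hS _ _ _
    have : S = ∅ := by simpa using hS
    simp [this]
  | succ n ih =>
    intro S D hS hC hD hI
    rcases S.eq_empty_or_nonempty with rfl | hne
    · simp
    let W : Finset Pt := P.filter fun w => (∃ f ∈ M, f.2 = w) ∧ (∀ a ∈ S, a.1 < w.1) ∧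
      w.1 < p.1 ∧ ∃ a ∈ S, ∃ b ∈ S, yOn (b, p) w.1 < w.2 ∧ w.2 < yOn (a, p) w.1
    rcases W.eq_empty_or_nonempty with hW | hW
    · obtain ⟨a, ha, hmax⟩ := S.exists_max_image (fun a => a.1) hne
      have haD : a ∉ D := by
        intro h
        have := (Finset.mem_filter.1 (hD a ha h)).2.2.1
        simp at this
      have hsub : ∀ b ∈ S.erase a, insert a D ⊆ VV P M p b := by
        intro b hb
        rw [Finset.mem_erase] at hb
        refine Finset.insert_subset ?_ (hD b hb.2)
        have hba : b.1 < a.1 := lt_of_le_of_ne (hmax b hb.2)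
          (hP.2 b (hC b hb.2).mem a (hC a ha).mem hb.1)
        refine mem_VV (hC a ha).mem (Or.inl ((hC a ha).iso hiso)) ?_
        refine vis_of hP hM hp (hC b hb.2) (hC a ha).mem hba (hC a ha).1 ?_
        intro f hf h1 h2 hlt
        have hya : yOn (a, p) a.1 = a.2 := yOn_left (a, p)
        have hfa : a.1 < f.2.1 := by
          refine lt_of_le_of_ne h2 (fun h => ?_)
          exact ((hC a ha).iso hiso f hf).2 (by
            by_contra hh
            exact hP.2 _ (hM.right_mem f hf) _ (hC a ha).mem hh h.symm)
        have : f.2 ∈ W := by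
          refine Finset.mem_filter.2 ⟨hM.right_mem f hf, ⟨f, hf, rfl⟩,
            fun c hc => lt_of_le_of_lt (hmax c hc) hfa, ?_⟩
          rw [mul_neg_iff] at hlt
          rcases hlt with h | h
          · have := right_end hM hiso (hC a ha) (hC b hb.2) hf le_rfl hba.le (hC a ha).1 h1 h2
              (by linarith) (by linarith)
            exact ⟨this.1, a, ha, b, hb.2, this.2⟩
          · have := right_end hM hiso (hC b hb.2) (hC a ha) hf hba.le le_rfl (hC a ha).1 h1 h2
              (by linarith) (by linarith)
            exact ⟨this.1, b, hb.2, a, ha, this.2⟩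
        rw [hW] at this; simp at this
      have := ih (S.erase a) (insert a D)
        (by rw [Finset.card_erase_of_mem ha]; omega)
        (fun b hb => hC b (Finset.mem_of_mem_erase hb)) hsub ?_
      · rw [Finset.card_insert_of_notMem haD] at this
        rw [← Finset.add_sum_erase _ _ ha]
        have h1 := Finset.card_le_card (hD a ha)
        have h2 := ff1 D.card
        omega
      · intro d hd
        rw [Finset.mem_insert] at hd
        rcases hd with rfl | hd
        · exact Or.inl ((hC _ ha).iso hiso)
        · exact (hI d hd).imp id fun h b hb c hc =>
            h b (Finset.mem_of_mem_erase hb) c (Finset.mem_of_mem_erase hc)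
    · obtain ⟨w, hw, hmax⟩ := W.exists_max_image (fun a => a.1) hW
      obtain ⟨hwP, ⟨f, hf, hfw⟩, hwS, hwp, a, ha, b, hb, hbw, haw⟩ := Finset.mem_filter.1 hw
      have hvis : ∀ c ∈ S, w ∈ VV P M p c := by
        intro c hc
        refine mem_VV hwP (Or.inr ⟨f, hf, hfw⟩) ?_
        refine vis_of hP hM hp (hC c hc) hwP (hwS c hc) hwp ?_
        intro g hg h1 h2 hlt
        have : g.2 ∈ W := by
          refine Finset.mem_filter.2 ⟨hM.right_mem g hg, ⟨g, hg, rfl⟩,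
            fun c hc => lt_of_lt_of_le (hwS c hc) h2, ?_⟩
          rw [mul_neg_iff] at hlt
          rcases hlt with h | h
          · have := right_end hM hiso (hC a ha) (hC c hc) hg (hwS a ha).le (hwS c hc).le hwp
              h1 h2 (by linarith) (by linarith)
            exact ⟨this.1, a, ha, c, hc, this.2⟩
          · have := right_end hM hiso (hC c hc) (hC b hb) hg (hwS c hc).le (hwS b hb).le hwp
              h1 h2 (by linarith) (by linarith)
            exact ⟨this.1, c, hc, b, hb, this.2⟩
        have h3 := le_antisymm (hmax _ this) h2
        have h4 : g.2 = w := by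
          by_contra hh; exact hP.2 _ (hM.right_mem g hg) _ hwP hh h3
        have h5 := yOn_right g (hM.x_lt g hg)
        rw [h4] at h5
        rw [h5] at hlt; simp at hlt
      have hwD : w ∉ D := by
        intro h
        rcases hI w h with h' | h'
        · exact (h' f hf).2 hfw
        · have := (h' b hb a ha).1 hbw
          linarith
      have hDc := Finset.card_insert_of_notMem hwD
      have step : ∀ Q : Pt → Prop, (∀ x y, Q x → Q y →
          (yOn (x, p) w.1 < w.2 ↔ yOn (y, p) w.1 < w.2)) → (∃ x ∈ S, ¬ Q x) →
          ∑ a ∈ S.filter Q, (4 - (VV P M p a).card) ≤ ff (D.card + 1) := by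
        intro Q hQ hx
        rw [← hDc]
        refine ih _ _ ?_ (fun a ha => hC a (Finset.mem_filter.1 ha).1) ?_ ?_
        · have := Finset.card_lt_card (Finset.filter_ssubset.2 hx)
          omega
        · intro a ha
          have ha := (Finset.mem_filter.1 ha).1
          exact Finset.insert_subset (hvis a ha) (hD a ha)
        · intro d hd
          rw [Finset.mem_insert] at hd
          rcases hd with rfl | hd
          · exact Or.inr fun b hb c hc =>
              hQ b c (Finset.mem_filter.1 hb).2 (Finset.mem_filter.1 hc).2
          · exact (hI d hd).imp id fun h b hb c hc =>
              h b (Finset.mem_filter.1 hb).1 c (Finset.mem_filter.1 hc).1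
      have s1 := step (fun x => yOn (x, p) w.1 < w.2) (fun x y hx hy => by simp [hx, hy])
        ⟨a, ha, by simpa using haw.le⟩
      have s2 := step (fun x => ¬ yOn (x, p) w.1 < w.2) (fun x y hx hy => by simp [hx, hy])
        ⟨b, hb, by simpa using hbw⟩
      rw [← Finset.sum_filter_add_sum_filter_not S (fun x => yOn (x, p) w.1 < w.2)]
      refine (add_le_add s1 ?_).trans (ff2 _)
      refine le_trans (le_of_eq (Finset.sum_congr ?_ fun _ _ => rfl)) s2
      ext x
      simp only [Finset.mem_filter]

/-- Points whose vertical segment to the line `cp` avoids all edges. -/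
def AA (M : Finset (Pt × Pt)) (p c : Pt) : Set Pt :=
  {u | ∀ y ∈ Set.uIcc u.2 (yOn (c, p) u.1), ((u.1, y) : Pt) ∉ edgesSet M}

theorem edges_closed (M : Finset (Pt × Pt)) : IsClosed (edgesSet M) := by
  refine Set.Finite.isClosed_biUnion M.finite_toSet fun e _ => ?_
  have : Seg e.1 e.2 = AffineMap.lineMap (k := ℝ) e.1 e.2 '' Set.Icc 0 1 :=
    segment_eq_image_lineMap ℝ e.1 e.2
  rw [this]
  exact (isCompact_Icc.image AffineMap.lineMap_continuous).isClosed

theorem AA_open (M : Finset (Pt × Pt)) (p c : Pt) : IsOpen (AA M p c) := by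
  have hc : Continuous fun z : Pt × Set.Icc (0:ℝ) 1 =>
      ((z.1.1, z.1.2 + (z.2 : ℝ) * (yOn (c, p) z.1.1 - z.1.2)) : Pt) := by
    have := yOn_cont (c, p)
    fun_prop
  have hcl := isClosedMap_fst_of_compactSpace _ ((edges_closed M).preimage hc)
  convert hcl.isOpen_compl using 1
  ext u
  simp only [AA, Set.mem_ofPred_eq, Set.mem_compl_iff, Set.mem_image, Set.mem_preimage,
    Prod.exists, not_exists, not_and, ← segment_eq_uIcc, segment_eq_image']
  constructor
  · rintro h a b t ht rfl
    exact h _ ⟨t, t.2, rfl⟩ ht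
  · rintro h y ⟨t, ht, rfl⟩ hm
    exact h u.1 u.2 ⟨t, ht⟩ hm rfl

/-- Points separated from the line `cp` by the edge `h`. -/
def BB (p c : Pt) (h : Pt × Pt) : Set Pt :=
  {u | h.1.1 < u.1 ∧ u.1 < h.2.1 ∧
    (u.2 - yOn h u.1) * (yOn (c, p) u.1 - yOn h u.1) < 0}

theorem BB_open (p c : Pt) (h : Pt × Pt) : IsOpen (BB p c h) := by
  have h1 := yOn_cont (c, p)
  have h2 := yOn_cont h
  have e1 : IsOpen {u : Pt | h.1.1 < u.1} := isOpen_lt (by fun_prop) (by fun_prop)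
  have e2 : IsOpen {u : Pt | u.1 < h.2.1} := isOpen_lt (by fun_prop) (by fun_prop)
  have e3 : IsOpen {u : Pt | (u.2 - yOn h u.1) * (yOn (c, p) u.1 - yOn h u.1) < 0} :=
    isOpen_lt (by fun_prop) (by fun_prop)
  exact e1.inter (e2.inter e3)

theorem mem_edges (hM : IsMatching P M) (z : Pt) : z ∈ edgesSet M ↔
    ∃ h ∈ M, h.1.1 ≤ z.1 ∧ z.1 ≤ h.2.1 ∧ z.2 = yOn h z.1 := by
  simp only [edgesSet, Set.mem_iUnion, exists_prop]
  exact exists_congr fun h => and_congr_right fun hh => mem_Seg_iff h (hM.x_lt h hh) z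

theorem BB_disj (hM : IsMatching P M) {c : Pt} {h : Pt × Pt} (hh : h ∈ M) {u : Pt}
    (hu : u ∈ closure (AA M p c)) : u ∉ BB p c h := by
  intro hb
  obtain ⟨v, ⟨h1, h2, h3⟩, hv⟩ := mem_closure_iff.1 hu _ (BB_open p c h) hb
  refine hv (yOn h v.1) ?_ ((mem_edges hM _).2 ⟨h, hh, h1.le, h2.le, rfl⟩)
  rw [Set.mem_uIcc]
  rw [mul_neg_iff] at h3
  rcases h3 with h3 | h3
  · right; constructor <;> linarith
  · left; constructor <;> linarith

theorem strict_btw {a b y : ℝ} (h : y ∈ Set.uIcc a b) (h1 : y ≠ a) (h2 : y ≠ b) :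
    (a - y) * (b - y) < 0 := by
  rw [Set.mem_uIcc] at h
  rcases h with ⟨h3, h4⟩ | ⟨h3, h4⟩
  · exact mul_neg_of_neg_of_pos (sub_neg.2 (lt_of_le_of_ne h3 h1.symm))
      (sub_pos.2 (lt_of_le_of_ne h4 h2))
  · exact mul_neg_of_pos_of_neg (sub_pos.2 (lt_of_le_of_ne h4 h1))
      (sub_neg.2 (lt_of_le_of_ne h3 h2.symm))

theorem AA_clopen (hP : GenPos P) (hM : IsMatching P M) (hiso : Isolated M p) {c : Pt}
    (hc : Cand P M p c) {u : Pt} (hu : u ∈ closure (AA M p c)) (hF : u ∈ FreeRegion P M)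
    (h1 : c.1 ≤ u.1) (h2 : u.1 ≤ p.1) : u ∈ AA M p c := by
  have hue : u ∉ edgesSet M := fun h => hF (Or.inl h)
  have hLe : ∀ h ∈ M, h.1.1 ≤ u.1 → u.1 ≤ h.2.1 → yOn h u.1 ≠ yOn (c, p) u.1 :=
    fun h hh a b => hc.yne hM hiso hh a b h1 h2
  have hUe : ∀ h ∈ M, h.1.1 ≤ u.1 → u.1 ≤ h.2.1 → yOn h u.1 ≠ u.2 :=
    fun h hh a b e => hue ((mem_edges hM _).2 ⟨h, hh, a, b, e.symm⟩)
  have main : ∀ y ∈ Set.uIcc u.2 (yOn (c, p) u.1), ∀ h ∈ M, h.1.1 < u.1 → u.1 < h.2.1 →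
      y ≠ yOn h u.1 := by
    rintro y hy h hh a b rfl
    exact BB_disj hM hh hu ⟨a, b, strict_btw hy (hUe h hh a.le b.le) (hLe h hh a.le b.le)⟩
  have main2 : ∀ y ∈ Set.uIcc u.2 (yOn (c, p) u.1), ∀ w ∈ P, w.1 = u.1 → w.2 ≠ y := by
    intro y hy w hw hwu hwy
    refine hF (Or.inr (Set.mem_iUnion₂.2 ⟨w, hw, hwu.symm, ?_⟩))
    intro z hz hzu hzw hze
    obtain ⟨h, hh, a, b, e⟩ := (mem_edges hM z).1 hze
    have a' : h.1.1 ≠ z.1 := by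
      intro ha
      have : h.1 = w := by
        by_contra hne; exact hP.2 _ (hM.left_mem h hh) _ hw hne (ha.trans hz)
      rw [← ha, yOn_left] at e
      exact hzw (Prod.ext hz (by rw [e, this]))
    have b' : z.1 ≠ h.2.1 := by
      intro hb
      have : h.2 = w := by
        by_contra hne; exact hP.2 _ (hM.right_mem h hh) _ hw hne (hb.symm.trans hz)
      rw [hb, yOn_right h (hM.x_lt h hh)] at e
      exact hzw (Prod.ext hz (by rw [e, this]))
    have hzx : z.1 = u.1 := hz.trans hwu
    rw [hzx] at a b a' b' e
    refine main z.2 ?_ h hh (lt_of_le_of_ne a a') (lt_of_le_of_ne b b') e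
    rw [hwy] at hzu
    exact Set.uIcc_subset_uIcc Set.left_mem_uIcc hy hzu
  intro y hy hye
  obtain ⟨h, hh, a, b, e⟩ := (mem_edges hM _).1 hye
  simp only at a b e
  rcases a.lt_or_eq with a | a
  · rcases b.lt_or_eq with b | b
    · exact main y hy h hh a b e
    · rw [b, yOn_right h (hM.x_lt h hh)] at e
      exact main2 y hy h.2 (hM.right_mem h hh) b.symm e.symm
  · rw [← a, yOn_left] at e
    exact main2 y hy h.1 (hM.left_mem h hh) a e.symm

theorem T_sub (hP : GenPos P) (hM : IsMatching P M) (hp : p ∈ P) (hiso : Isolated M p) {c : Pt}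
    (hc : Cand P M p c) {T : Set Pt} (hT : IsLeftCellOf P M p T) (hpe : p ∉ edgesSet M) :
    T ⊆ AA M p c ∩ {u | c.1 < u.1} := by
  obtain ⟨⟨x, hx, hTx⟩, ε₀, hε₀, hT⟩ := hT
  have hpre : IsPreconnected T := hTx ▸ isPreconnected_connectedComponentIn
  have hTF : T ⊆ FreeRegion P M := hTx ▸ connectedComponentIn_subset _ _
  have hpy : yOn (c, p) p.1 = p.2 := yOn_right (c, p) hc.1
  have hcy : yOn (c, p) c.1 = c.2 := yOn_left (c, p)
  have hsub : T ⊆ AA M p c ∩ ({u | c.1 < u.1} ∩ {u | u.1 < p.1}) := by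
    refine hpre.subset_of_closure_inter_subset ?_ ?_ ?_
    · exact (AA_open M p c).inter ((isOpen_lt (by fun_prop) (by fun_prop)).inter
        (isOpen_lt (by fun_prop) (by fun_prop)))
    · have hpA : p ∈ AA M p c := by
        intro y hy
        rw [hpy] at hy
        have : y = p.2 := by simpa using hy
        rw [this]; exact hpe
      have hcont : Continuous fun ε : ℝ => ((p.1 - ε, p.2) : Pt) := by fun_prop
      have ev : ∀ᶠ ε in nhds (0:ℝ), ((p.1 - ε, p.2) : Pt) ∈ AA M p c :=
        hcont.continuousAt.eventually ((AA_open M p c).mem_nhds (by simpa using hpA))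
      obtain ⟨δ, hδ, hb⟩ := Metric.eventually_nhds_iff.1 ev
      have hcp := sub_pos.2 hc.1
      obtain ⟨ε, he0, he⟩ := exists_between (lt_min hε₀ (lt_min hδ hcp))
      rw [lt_min_iff, lt_min_iff] at he
      refine ⟨_, hT ε he0 he.1, hb ?_, ?_, ?_⟩
      · simp [abs_of_pos he0, he.2.1]
      · simp; linarith
      · simp; exact he0
    · rintro u ⟨hu, huT⟩
      have hF := hTF huT
      have e1 : u ∈ closure (AA M p c) := closure_mono Set.inter_subset_left hu
      have e2 : c.1 ≤ u.1 := by
        refine closure_minimal (s := AA M p c ∩ ({u | c.1 < u.1} ∩ {u | u.1 < p.1}))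
          (t := {u | c.1 ≤ u.1}) ?_ (isClosed_le (by fun_prop) (by fun_prop)) hu
        rintro v ⟨_, hv, _⟩; exact LT.lt.le (a := c.1) (b := v.1) hv
      have e3 : u.1 ≤ p.1 := by
        refine closure_minimal (s := AA M p c ∩ ({u | c.1 < u.1} ∩ {u | u.1 < p.1}))
          (t := {u | u.1 ≤ p.1}) ?_ (isClosed_le (by fun_prop) (by fun_prop)) hu
        rintro v ⟨_, _, hv⟩; exact LT.lt.le (a := v.1) (b := p.1) hv
      have hA := AA_clopen hP hM hiso hc e1 hF e2 e3
      have wall : ∀ r ∈ P, yOn (c, p) r.1 = r.2 → u.1 ≠ r.1 := by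
        intro r hr hy hur
        refine hF (Or.inr (Set.mem_iUnion₂.2 ⟨r, hr, hur, ?_⟩))
        intro z hz hz2 _ hze
        refine hA z.2 ?_ ?_
        · rw [hur, hy]; exact hz2
        · rw [hur, ← hz]; exact hze
      exact ⟨hA, lt_of_le_of_ne e2 (wall c hc.mem hcy).symm,
        lt_of_le_of_ne e3 (wall p hp hpy)⟩
  exact fun u hu => ⟨(hsub hu).1, (hsub hu).2.1⟩

theorem bif_sees (hP : GenPos P) (hM : IsMatching P M) (hp : p ∈ P) (hiso : Isolated M p)
    {c q : Pt} (hc : Cand P M p c) (hq : IsLeftBifPoint P M p q) (hqiso : Isolated M q)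
    (hpe : p ∉ edgesSet M) (hcq : c ≠ q) : q ∈ VV P M p c := by
  obtain ⟨hqP, T, hT, ⟨z, hzT, hzW⟩, hglb⟩ := hq
  have hsub := T_sub hP hM hp hiso hc hT hpe
  have hqp : q.1 < p.1 := by
    obtain ⟨_, ε, hε, h⟩ := hT
    have := hglb.1 ⟨p.2, h (ε / 2) (by linarith) (by linarith)⟩
    linarith
  have hle : c.1 ≤ q.1 := hglb.2 (by rintro x ⟨y, hy⟩; exact le_of_lt (hsub hy).2)
  have hlt : c.1 < q.1 := lt_of_le_of_ne hle (hP.2 c hc.mem q hqP hcq)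
  refine mem_VV hqP (Or.inl hqiso) (vis_of hP hM hp hc hqP hlt hqp ?_)
  intro f hf h1 h2 hb
  have h1' : f.1.1 < q.1 := lt_of_le_of_ne h1 (hP.2 _ (hM.left_mem f hf) _ hqP (hqiso f hf).1)
  have h2' : q.1 < f.2.1 :=
    lt_of_le_of_ne h2 (hP.2 _ (hM.right_mem f hf) _ hqP (hqiso f hf).2).symm
  have hzc : z ∈ closure (AA M p c) :=
    closure_mono (fun u hu => (hsub hu).1) (frontier_subset_closure hzT)
  obtain ⟨hz1, hz2⟩ := hzW
  have hne : yOn f q.1 ≠ q.2 := by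
    intro h; rw [h] at hb; simp at hb
  have hnot : yOn f q.1 ∉ Set.uIcc z.2 q.2 := by
    intro h
    refine hz2 (q.1, yOn f q.1) rfl h (fun h => hne (congrArg Prod.snd h)) ?_
    exact (mem_edges hM _).2 ⟨f, hf, h1, h2, rfl⟩
  refine BB_disj hM hf hzc ⟨by rw [hz1]; exact h1', by rw [hz1]; exact h2', ?_⟩
  rw [hz1]
  rw [Set.mem_uIcc] at hnot
  push Not at hnot
  rw [mul_neg_iff] at hb ⊢
  rcases hb with ⟨a, b⟩ | ⟨a, b⟩
  · left
    refine ⟨?_, b⟩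
    by_contra hh
    have := hnot.1 (by linarith)
    linarith
  · right
    refine ⟨?_, b⟩
    by_contra hh
    have := hnot.2 (by linarith)
    linarith

end

/-- If `p` is isolated in `M` and the left bifurcation
point of `p` exists and is isolated in `M`, then
`Σ_{i=0}^{4} (4−i)·l_i(p,M) ≤ 10`. -/
theorem weighted_lcount_four_le (P : Finset Pt) (hP : GenPos P)
    (M : Finset (Pt × Pt)) (hM : IsMatching P M)
    (p : Pt) (hp : p ∈ P) (hiso : Isolated M p)
    (q : Pt) (hq : IsLeftBifPoint P M p q) (hqiso : Isolated M q) :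
    ∑ i ∈ Finset.range 5, (4 - i) * lcount P M p i ≤ 10 := by
  let C : Finset Pt := P.filter fun c => Cand P M p c
  have hC : ∀ c ∈ C, Cand P M p c := fun c hc => (Finset.mem_filter.1 hc).2
  have hsum : ∑ i ∈ Finset.range 5, (4 - i) * lcount P M p i
      ≤ ∑ c ∈ C, (4 - (VV P M p c).card) := by
    have hl : ∀ i, lcount P M p i = (C.filter fun c => (VV P M p c).card = i).card := by
      intro i
      unfold lcount
      congr 1
      ext c
      rw [Finset.mem_filter, Finset.mem_filter, Finset.mem_filter]
      unfold Cand
      constructor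
      · rintro ⟨a, b, d, e⟩
        exact ⟨⟨a, b, d⟩, by rw [← rank_eq hiso ⟨b, d⟩]; exact e⟩
      · rintro ⟨⟨a, b, d⟩, e⟩
        exact ⟨a, b, d, by rw [rank_eq hiso ⟨b, d⟩]; exact e⟩
    simp only [hl, Finset.card_filter, Finset.mul_sum]
    rw [Finset.sum_comm]
    refine Finset.sum_le_sum fun c _ => ?_
    simp only [mul_ite, mul_one, mul_zero, Finset.sum_ite_eq]
    split_ifs <;> simp
  refine hsum.trans ?_
  have hpe : p ∉ edgesSet M := by
    intro h
    obtain ⟨f, hf, a, b, e⟩ := (mem_edges hM p).1 h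
    have hx := hM.x_lt f hf
    refine hP.1 f.1 (hM.left_mem f hf) p hp f.2 (hM.right_mem f hf) (hiso f hf).1
      (hiso f hf).2.symm (fun h => by simp [h] at hx) ?_
    exact (mem_segment_iff_wbtw.1 ((mem_Seg_iff f hx p).2 ⟨a, b, e⟩)).collinear
  have h1 := main_ind hP hM hp hiso _ (C.erase q) {q} le_rfl
    (fun a ha => hC a (Finset.mem_of_mem_erase ha))
    (fun a ha => by
      rw [Finset.singleton_subset_iff]
      exact bif_sees hP hM hp hiso (hC a (Finset.mem_of_mem_erase ha)) hq hqiso hpe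
        (Finset.ne_of_mem_erase ha))
    (fun d hd => by rw [Finset.mem_singleton] at hd; rw [hd]; exact Or.inl hqiso)
  have h2 : ff ({q} : Finset Pt).card = 6 := by simp [ff]
  rw [h2] at h1
  by_cases hqC : q ∈ C
  · rw [← Finset.add_sum_erase _ _ hqC]; omega
  · rw [Finset.erase_eq_of_notMem hqC] at h1; omega
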